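/- arXiv:2310.11652 — 4 statements merged into one kernel-verified Lean document; each statement's English description precedes it below -/
import Mathlib

section
/- Let (X, Σ) be a measurable space carrying two measures μ and m, let p ∈ [2, ∞) and α ≥ 0. Let f, g : X → ℝ be measurable with ∫_X |f|^p dm < ∞ and ∫_X |g|^p dm < ∞, and let Γ_f, Γ_g, Γ_+, Γ_− : X → [0, ∞) be measurable functions satisfying the parallelogram identity Γ_+ + Γ_− = (Γ_f + Γ_g)/2 μ-almost everywhere. Define E_α(h, Γ) := ∫_X Γ^{p/2} dμ + α ∫_X |h|^p dm (with values in [0, ∞]). Then E_α((f+g)/2, Γ_+) + E_α((f−g)/2, Γ_−) ≤ (E_α(f, Γ_f) + E_α(g, Γ_g))/2. -/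
open MeasureTheory ENNReal

/-- The α-order energy `E_α(h, Γ) := ∫ Γ^{p/2} dμ + α ∫ |h|^p dm`, with values in `[0,∞]`. -/
noncomputable def energyAlpha {X : Type*} [MeasurableSpace X]
    (μ m : Measure X) (p α : ℝ) (h : X → ℝ) (Γ : X → NNReal) : ℝ≥0∞ :=
  (∫⁻ x, (Γ x : ℝ≥0∞) ^ (p / 2) ∂μ) +
    ENNReal.ofReal α * ∫⁻ x, ENNReal.ofReal (|h x| ^ p) ∂m

/-- Superadditivity and midpoint convexity of `t ↦ t ^ q`, for `q ≥ 1`, combined. -/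
theorem ENNReal.rpow_add_rpow_le_half_of_add_eq {a b c d : ℝ≥0∞} {q : ℝ} (hq : 1 ≤ q)
    (h : a + b = (c + d) / 2) : a ^ q + b ^ q ≤ (c ^ q + d ^ q) / 2 := by
  have hmean := ENNReal.rpow_arith_mean_le_arith_mean2_rpow 2⁻¹ 2⁻¹ c d
    ENNReal.inv_two_add_inv_two hq
  calc a ^ q + b ^ q ≤ (a + b) ^ q := ENNReal.add_rpow_le_rpow_add a b hq
    _ ≤ (c ^ q + d ^ q) / 2 := by
      rwa [h, ENNReal.div_eq_inv_mul, ENNReal.div_eq_inv_mul, mul_add, mul_add]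

/-- A pointwise parallelogram identity integrates to a Clarkson inequality. -/
theorem MeasureTheory.lintegral_rpow_add_lintegral_rpow_le_half {X : Type*} [MeasurableSpace X]
    {ν : Measure X} {a b c d : X → ℝ≥0∞} {q : ℝ} (hq : 1 ≤ q) (ha : AEMeasurable a ν)
    (hc : AEMeasurable c ν) (h : ∀ᵐ x ∂ν, a x + b x = (c x + d x) / 2) :
    (∫⁻ x, a x ^ q ∂ν) + ∫⁻ x, b x ^ q ∂ν
      ≤ ((∫⁻ x, c x ^ q ∂ν) + ∫⁻ x, d x ^ q ∂ν) / 2 := by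
  rw [← lintegral_add_left' (ha.pow_const q), ← lintegral_add_left' (hc.pow_const q),
    ENNReal.div_eq_inv_mul, ← lintegral_const_mul' _ _ (by simp)]
  refine lintegral_mono_ae (h.mono fun x hx => ?_)
  rw [← ENNReal.div_eq_inv_mul]
  exact ENNReal.rpow_add_rpow_le_half_of_add_eq hq hx

theorem ENNReal.ofReal_abs_rpow_eq_ofReal_sq_rpow {p : ℝ} (hp : 0 ≤ p) (t : ℝ) :
    ENNReal.ofReal (|t| ^ p) = ENNReal.ofReal (t ^ 2) ^ (p / 2) := by
  rw [ENNReal.ofReal_rpow_of_nonneg (sq_nonneg t) (by positivity), ← sq_abs,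
    ← Real.rpow_natCast, ← Real.rpow_mul (abs_nonneg t)]
  congr 2
  push_cast
  ring

theorem clarkson_type_inequality_p_ge_two {X : Type*} [MeasurableSpace X]
    (μ m : Measure X) (p α : ℝ) (hp : 2 ≤ p) (hα : 0 ≤ α)
    (f g : X → ℝ) (hf : Measurable f) (hg : Measurable g)
    (hfp : ∫⁻ x, ENNReal.ofReal (|f x| ^ p) ∂m < ∞)
    (hgp : ∫⁻ x, ENNReal.ofReal (|g x| ^ p) ∂m < ∞)
    (Γf Γg Γplus Γminus : X → NNReal)
    (hΓf : Measurable Γf) (hΓg : Measurable Γg)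
    (hΓplus : Measurable Γplus) (hΓminus : Measurable Γminus)
    (hpar : ∀ᵐ x ∂μ, Γplus x + Γminus x = (Γf x + Γg x) / 2) :
    energyAlpha μ m p α (fun x => (f x + g x) / 2) Γplus
      + energyAlpha μ m p α (fun x => (f x - g x) / 2) Γminus
      ≤ (energyAlpha μ m p α f Γf + energyAlpha μ m p α g Γg) / 2 := by
  have hq : 1 ≤ p / 2 := by linarith
  have hΓ := lintegral_rpow_add_lintegral_rpow_le_half (ν := μ) hq
    hΓplus.coe_nnreal_ennreal.aemeasurable hΓf.coe_nnreal_ennreal.aemeasurable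
    (b := fun x => (Γminus x : ℝ≥0∞)) (d := fun x => (Γg x : ℝ≥0∞))
    (hpar.mono fun x hx => by
      have := congrArg ((↑) : NNReal → ℝ≥0∞) hx
      simpa [ENNReal.coe_div] using this)
  have hm := lintegral_rpow_add_lintegral_rpow_le_half (ν := m) hq
    (a := fun x => ENNReal.ofReal (((f x + g x) / 2) ^ 2))
    (b := fun x => ENNReal.ofReal (((f x - g x) / 2) ^ 2))
    (c := fun x => ENNReal.ofReal (f x ^ 2)) (d := fun x => ENNReal.ofReal (g x ^ 2))
    (by fun_prop) (by fun_prop) (.of_forall fun x => by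
      rw [← ENNReal.ofReal_add (by positivity) (by positivity),
        ← ENNReal.ofReal_add (by positivity) (by positivity),
        ← ENNReal.ofReal_ofNat 2, ← ENNReal.ofReal_div_of_pos two_pos]
      congr 1
      ring)
  simp only [energyAlpha, ENNReal.ofReal_abs_rpow_eq_ofReal_sq_rpow (by linarith : 0 ≤ p)]
  rw [add_add_add_comm, ← mul_add, add_add_add_comm (∫⁻ x, (Γf x : ℝ≥0∞) ^ (p / 2) ∂μ),
    ← mul_add, ENNReal.add_div, mul_div_assoc]
  gcongr
end

section
/- Let (X, Σ) be a measurable space carrying two measures μ and m, let p ∈ (1, 2] and α ≥ 0, and set q := p/(p−1). Let f, g : X → ℝ be measurable with ∫_X |f|^p dm < ∞ and ∫_X |g|^p dm < ∞, and let Γ_f, Γ_g, Γ_+, Γ_− : X → [0, ∞) be measurable functions with ∫_X Γ_f^{p/2} dμ < ∞ and ∫_X Γ_g^{p/2} dμ < ∞, satisfying μ-almost everywhere the parallelogram identity Γ_+ + Γ_− = (Γ_f + Γ_g)/2 together with the Cauchy–Schwarz bounds (Γ_f^{1/2} − Γ_g^{1/2})² ≤ 4 Γ_+ ≤ (Γ_f^{1/2}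 + Γ_g^{1/2})². Define E_α(h, Γ) := ∫_X Γ^{p/2} dμ + α ∫_X |h|^p dm. Then E_α((f+g)/2, Γ_+)^{1/(p−1)} + E_α((f−g)/2, Γ_−)^{1/(p−1)} ≤ ((E_α(f, Γ_f) + E_α(g, Γ_g))/2)^{1/(p−1)}. -/
open MeasureTheory ENNReal

open Real in
/-- For fixed `x ∈ (0, 1]`, Friedrichs' interpolating function is antitone between `x ^ (p - 1)` and
`1`, and comparing its endpoint values gives Clarkson's two-point inequality. -/
lemma one_add_rpow_add_one_sub_rpow_le {p r x : ℝ} (hr : 1 ≤ r) (hpr : r * (p - 1) = 1)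
    (hx0 : 0 < x) (hx1 : x ≤ 1) :
    (1 + x) ^ (r + 1) + (1 - x) ^ (r + 1) ≤ 2 * (1 + x ^ p) ^ r := by
  have hp : 0 < p - 1 := by
    by_contra! h
    nlinarith
  set t : ℝ := x ^ (p - 1) with ht
  have ht0 : 0 < t := rpow_pos_of_pos hx0 _
  have ht1 : t ≤ 1 := rpow_le_one hx0.le hx1 hp.le
  let F : ℝ → ℝ := fun s =>
    (1 + s ^ (-r) * x) * (1 + s * x) ^ r + (1 - s ^ (-r) * x) * (1 - s * x) ^ r
  have hcont : ContinuousOn F (Set.Icc t 1) := by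
    have hpow : ContinuousOn (fun s : ℝ => s ^ (-r)) (Set.Icc t 1) := fun s hs =>
      (continuousAt_rpow_const _ _ (Or.inl (ht0.trans_le hs.1).ne')).continuousWithinAt
    have hplus : Continuous fun s : ℝ => (1 + s * x) ^ r :=
      (by fun_prop : Continuous fun s : ℝ => 1 + s * x).rpow_const fun _ => Or.inr (by linarith)
    have hminus : Continuous fun s : ℝ => (1 - s * x) ^ r :=
      (by fun_prop : Continuous fun s : ℝ => 1 - s * x).rpow_const fun _ => Or.inr (by linarith)
    exact ((continuousOn_const.add (hpow.mul_const x)).mul hplus.continuousOn).add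
      ((continuousOn_const.sub (hpow.mul_const x)).mul hminus.continuousOn)
  have hderiv : ∀ s ∈ interior (Set.Icc t 1), HasDerivAt F
      (r * x * (1 - s ^ (-r - 1)) * ((1 + s * x) ^ (r - 1) - (1 - s * x) ^ (r - 1))) s := by
    intro s hs
    rw [interior_Icc] at hs
    have hs0 : 0 < s := ht0.trans hs.1
    have hsx : 0 < 1 - s * x := by nlinarith [hs.2]
    have hsx' : 0 < 1 + s * x := by positivity
    have h1 : HasDerivAt (fun s : ℝ => s ^ (-r) * x) (-r * s ^ (-r - 1) * x) s :=
      (hasDerivAt_rpow_const (Or.inl hs0.ne')).mul_const x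
    have h2 : HasDerivAt (fun s : ℝ => s * x) x s := by
      simpa using (hasDerivAt_id s).mul_const x
    have h3 := (h2.const_add 1).rpow_const (p := r) (Or.inl hsx'.ne')
    have h4 := (h2.const_sub 1).rpow_const (p := r) (Or.inl hsx.ne')
    refine (((h1.const_add 1).mul h3).add ((h1.const_sub 1).mul h4)).congr_deriv ?_
    have e1 : (1 + s * x) ^ r = (1 + s * x) ^ (r - 1) * (1 + s * x) := by
      rw [← rpow_add_one hsx'.ne', sub_add_cancel]
    have e2 : (1 - s * x) ^ r = (1 - s * x) ^ (r - 1) * (1 - s * x) := by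
      rw [← rpow_add_one hsx.ne', sub_add_cancel]
    have e3 : s ^ (-r) = s ^ (-r - 1) * s := by
      rw [← rpow_add_one hs0.ne', sub_add_cancel]
    rw [e1, e2, e3]
    ring
  have hanti : AntitoneOn F (Set.Icc t 1) := by
    refine antitoneOn_of_deriv_nonpos (convex_Icc t 1) hcont
      (fun s hs => (hderiv s hs).differentiableAt.differentiableWithinAt) fun s hs => ?_
    rw [(hderiv s hs).deriv]
    rw [interior_Icc] at hs
    have hs0 : 0 < s := ht0.trans hs.1
    have hsx : 0 ≤ 1 - s * x := by nlinarith [hs.2]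
    have h1 : 1 ≤ s ^ (-r - 1) :=
      one_le_rpow_of_pos_of_le_one_of_nonpos hs0 hs.2.le (by linarith)
    have h2 : (1 - s * x) ^ (r - 1) ≤ (1 + s * x) ^ (r - 1) :=
      rpow_le_rpow hsx (by nlinarith) (by linarith)
    refine mul_nonpos_of_nonpos_of_nonneg ?_ (by linarith)
    exact mul_nonpos_of_nonneg_of_nonpos (by positivity) (by linarith)
  have key := hanti (Set.left_mem_Icc.2 ht1) (Set.right_mem_Icc.2 ht1) ht1
  have htr : t ^ (-r) * x = 1 := by
    rw [ht, ← rpow_mul hx0.le, show (p - 1) * -r = -1 by linarith, Real.rpow_neg_one,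
      inv_mul_cancel₀ hx0.ne']
  have htx : t * x = x ^ p := by
    rw [ht, ← rpow_add_one hx0.ne', sub_add_cancel]
  simp only [F, htr, htx, Real.one_rpow, one_mul, sub_self, zero_mul, add_zero] at key
  rw [rpow_add_one' (by linarith) (by linarith), rpow_add_one' (by linarith) (by linarith)]
  linarith

open Real in
lemma add_rpow_add_abs_sub_rpow_le {p r a b : ℝ} (hr : 1 ≤ r) (hpr : r * (p - 1) = 1)
    (ha : 0 ≤ a) (hb : 0 ≤ b) :
    (a + b) ^ (r + 1) + |a - b| ^ (r + 1) ≤ 2 * (a ^ p + b ^ p) ^ r := by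
  wlog hab : b ≤ a generalizing a b
  · simpa only [add_comm, abs_sub_comm] using this hb ha (not_le.1 hab).le
  have hp : 0 < p := by
    by_contra! h
    nlinarith
  have hpow : ∀ c : ℝ, 0 ≤ c → (c ^ p) ^ r = c ^ (r + 1) := fun c hc => by
    rw [← rpow_mul hc, show p * r = r + 1 by linarith]
  rcases hb.eq_or_lt with rfl | hb
  · simp only [add_zero, sub_zero, abs_of_nonneg ha, zero_rpow hp.ne', hpow a ha]
    linarith
  have ha : 0 < a := hb.trans_le hab
  have key := mul_le_mul_of_nonneg_left (one_add_rpow_add_one_sub_rpow_le hr hpr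
    (div_pos hb ha) ((div_le_one ha).2 hab)) (rpow_nonneg ha.le (r + 1))
  have hba : b / a ≤ 1 := (div_le_one ha).2 hab
  rw [mul_add, ← mul_rpow ha.le (by positivity), ← mul_rpow ha.le (by linarith), mul_left_comm,
    ← hpow a ha.le, ← mul_rpow (by positivity) (by positivity), mul_add, mul_add, mul_sub,
    ← mul_rpow ha.le (by positivity), mul_one, mul_one, mul_div_cancel₀ _ ha.ne'] at key
  rwa [abs_of_nonneg (sub_nonneg.2 hab)]

/-- A convex function of two points with a fixed sum is larger when the points are further apart. -/
lemma ConvexOn.add_le_add_of_mem_Icc {s : Set ℝ} {φ : ℝ → ℝ} (hφ : ConvexOn ℝ s φ) {u v P M : ℝ}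
    (hu : u ∈ s) (hv : v ∈ s) (huP : u ≤ P) (hPv : P ≤ v) (hsum : P + M = u + v) :
    φ P + φ M ≤ φ u + φ v := by
  obtain ⟨c, d, hc, hd, hcd, rfl⟩ := (segment_eq_Icc (huP.trans hPv)).ge
    ⟨huP, hPv⟩
  have hM : M = d • u + c • v := by
    simp only [smul_eq_mul] at hsum ⊢
    linear_combination hsum - (u + v) * hcd
  have h1 := hφ.2 hu hv hc hd hcd
  have h2 := hφ.2 hu hv hd hc ((add_comm d c).trans hcd)
  rw [hM]
  simp only [smul_eq_mul] at h1 h2 ⊢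
  linear_combination h1 + h2 + (φ u + φ v) * hcd

open Real in
lemma rpow_rpow_add_rpow_rpow_le_of_parallelogram {p r G H P M : ℝ} (hr : 1 ≤ r)
    (hpr : r * (p - 1) = 1) (hG : 0 ≤ G) (hH : 0 ≤ H) (hP : 0 ≤ P) (hM : 0 ≤ M)
    (hpar : P + M = (G + H) / 2) (hlow : (√G - √H) ^ 2 ≤ 4 * P) (hup : 4 * P ≤ (√G + √H) ^ 2) :
    (P ^ (p / 2)) ^ r + (M ^ (p / 2)) ^ r ≤ ((G ^ (p / 2) + H ^ (p / 2)) / 2) ^ r := by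
  have hsq : ∀ c : ℝ, (c ^ 2) ^ ((r + 1) / 2) = |c| ^ (r + 1) := fun c => by
    rw [← sq_abs, ← Real.rpow_natCast, ← rpow_mul (abs_nonneg c)]
    congr 1
    push_cast
    ring
  have hsqrt : ∀ c : ℝ, 0 ≤ c → √c ^ p = c ^ (p / 2) := fun c hc => by
    rw [sqrt_eq_rpow, ← rpow_mul hc]
    congr 1
    ring
  have hconv := (convexOn_rpow (show 1 ≤ (r + 1) / 2 by linarith)).add_le_add_of_mem_Icc
    (sq_nonneg (√G - √H)) (sq_nonneg (√G + √H)) hlow hup (M := 4 * M)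
    (by nlinarith [sq_sqrt hG, sq_sqrt hH])
  have htwo := add_rpow_add_abs_sub_rpow_le hr hpr (sqrt_nonneg G) (sqrt_nonneg H)
  simp only [hsq, abs_of_nonneg (add_nonneg (sqrt_nonneg G) (sqrt_nonneg H))] at hconv
  rw [hsqrt G hG, hsqrt H hH] at htwo
  have hfour : (4 : ℝ) ^ ((r + 1) / 2) = 2 * 2 ^ r := by
    rw [show (4 : ℝ) = 2 ^ 2 by norm_num, hsq, abs_two, rpow_add_one two_ne_zero, mul_comm]
  have hexp : ∀ c : ℝ, 0 ≤ c → (c ^ (p / 2)) ^ r = c ^ ((r + 1) / 2) := fun c hc => by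
    rw [← rpow_mul hc]
    congr 1
    linarith
  rw [mul_rpow (by norm_num) hP, mul_rpow (by norm_num) hM, hfour] at hconv
  rw [hexp P hP, hexp M hM, div_rpow (by positivity) zero_le_two, le_div_iff₀ (by positivity)]
  linarith

/-- Minkowski's integral inequality for functions with values in `ℓ^r` of dimension two. -/
lemma lintegral_rpow_add_lintegral_rpow_le {X : Type*} [MeasurableSpace X] {ν : Measure X}
    {r : ℝ} (hr : 1 ≤ r) {A B C : X → ℝ≥0∞} (hA : AEMeasurable A ν) (hB : AEMeasurable B ν)
    (h : ∀ᵐ x ∂ν, A x ^ r + B x ^ r ≤ C x ^ r) :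
    (∫⁻ x, A x ∂ν) ^ r + (∫⁻ x, B x ∂ν) ^ r ≤ (∫⁻ x, C x ∂ν) ^ r := by
  have hr0 : 0 < r := by linarith
  rcases hr.eq_or_lt with rfl | hr1
  · simp only [ENNReal.rpow_one] at h ⊢
    rw [← lintegral_add_left' hA]
    exact lintegral_mono_ae h
  by_cases hC : ∫⁻ x, C x ∂ν = ∞
  · simp [hC, hr0]
  have hAC : ∫⁻ x, A x ∂ν ≤ ∫⁻ x, C x ∂ν := lintegral_mono_ae <| h.mono fun x hx =>
    (ENNReal.rpow_le_rpow_iff hr0).1 (le_self_add.trans hx)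
  have hBC : ∫⁻ x, B x ∂ν ≤ ∫⁻ x, C x ∂ν := lintegral_mono_ae <| h.mono fun x hx =>
    (ENNReal.rpow_le_rpow_iff hr0).1 (le_add_self.trans hx)
  set U := ∫⁻ x, A x ∂ν
  set V := ∫⁻ x, B x ∂ν
  set W := ∫⁻ x, C x ∂ν
  have hU : U ≠ ∞ := ne_top_of_le_ne_top hC hAC
  have hV : V ≠ ∞ := ne_top_of_le_ne_top hC hBC
  set K := U ^ r + V ^ r with hK
  have hK_top : K ≠ ∞ := by finiteness
  rcases eq_or_ne K 0 with hK0 | hK0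
  · simp [hK0]
  have hconj : (r.conjExponent).HolderConjugate r := (Real.HolderConjugate.conjExponent hr1).symm
  have hexp : (r - 1) * r.conjExponent = r := by
    rw [Real.conjExponent, mul_div_cancel₀ _ (by linarith)]
  have hpoint : ∀ᵐ x ∂ν, U ^ (r - 1) * A x + V ^ (r - 1) * B x ≤
      K ^ (1 / r.conjExponent) * C x := by
    filter_upwards [h] with x hx
    have := ENNReal.inner_le_Lp_mul_Lq Finset.univ ![U ^ (r - 1), V ^ (r - 1)] ![A x, B x] hconj
    simp only [Fin.sum_univ_two, Matrix.cons_val_zero, Matrix.cons_val_one, ← ENNReal.rpow_mul,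
      hexp, ← hK] at this
    refine this.trans ?_
    gcongr
    rw [one_div, ENNReal.rpow_inv_le_iff hr0]
    exact hx
  have hsplit : ∀ Y : ℝ≥0∞, Y ^ r = Y ^ (r - 1) * Y := fun Y => by
    conv_rhs => rw [← ENNReal.rpow_one Y, ← ENNReal.rpow_mul, one_mul]
    rw [← ENNReal.rpow_add_of_nonneg _ _ (by linarith) zero_le_one, sub_add_cancel]
  have hKW : K ≤ K ^ (1 / r.conjExponent) * W := by
    calc K = ∫⁻ x, U ^ (r - 1) * A x + V ^ (r - 1) * B x ∂ν := by
          rw [lintegral_add_left' (hA.const_mul _), lintegral_const_mul'' _ hA,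
            lintegral_const_mul'' _ hB, hK, hsplit U, hsplit V]
      _ ≤ ∫⁻ x, K ^ (1 / r.conjExponent) * C x ∂ν := lintegral_mono_ae hpoint
      _ = K ^ (1 / r.conjExponent) * W := lintegral_const_mul' _ _
          (ENNReal.rpow_ne_top_of_nonneg (one_div_nonneg.2 hconj.nonneg) hK_top)
  have hKsplit : K = K ^ (1 / r.conjExponent) * K ^ (1 / r) := by
    rw [← ENNReal.rpow_add _ _ hK0 hK_top, one_div, one_div, hconj.inv_add_inv_eq_one,
      ENNReal.rpow_one]
  have hKr : K ^ (1 / r) ≤ W := by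
    have hexp0 : 0 ≤ 1 / r.conjExponent := one_div_nonneg.2 hconj.nonneg
    exact (ENNReal.mul_le_mul_iff_right (ENNReal.rpow_pos (pos_iff_ne_zero.2 hK0) hK_top).ne'
      (ENNReal.rpow_ne_top_of_nonneg hexp0 hK_top)).1 (hKsplit.symm.trans_le hKW)
  rwa [one_div, ENNReal.rpow_inv_le_iff hr0] at hKr

lemma add_rpow_add_add_rpow_le {r : ℝ} (hr : 1 ≤ r) {U₁ U₂ V₁ V₂ W₁ W₂ : ℝ≥0∞}
    (h₁ : U₁ ^ r + V₁ ^ r ≤ W₁ ^ r) (h₂ : U₂ ^ r + V₂ ^ r ≤ W₂ ^ r) :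
    (U₁ + U₂) ^ r + (V₁ + V₂) ^ r ≤ (W₁ + W₂) ^ r := by
  have hr0 : 0 < r := by linarith
  have := ENNReal.Lp_add_le Finset.univ ![U₁, V₁] ![U₂, V₂] hr
  simp only [Fin.sum_univ_two, Matrix.cons_val_zero, Matrix.cons_val_one, one_div] at this
  rw [← ENNReal.rpow_inv_le_iff hr0] at h₁ h₂ ⊢
  exact this.trans (add_le_add h₁ h₂)

lemma lintegral_rpow_half_rpow_add_le_of_parallelogram {X : Type*} [MeasurableSpace X]
    {ν : Measure X} {p r : ℝ} (hr : 1 ≤ r) (hpr : r * (p - 1) = 1)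
    {Γf Γg Γplus Γminus : X → NNReal} (hΓf : Measurable Γf)
    (hΓplus : Measurable Γplus) (hΓminus : Measurable Γminus)
    (hpar : ∀ᵐ x ∂ν, Γplus x + Γminus x = (Γf x + Γg x) / 2)
    (hCS : ∀ᵐ x ∂ν,
      (Real.sqrt (Γf x) - Real.sqrt (Γg x)) ^ 2 ≤ 4 * (Γplus x : ℝ) ∧
        4 * (Γplus x : ℝ) ≤ (Real.sqrt (Γf x) + Real.sqrt (Γg x)) ^ 2) :
    (∫⁻ x, (Γplus x : ℝ≥0∞) ^ (p / 2) ∂ν) ^ r + (∫⁻ x, (Γminus x : ℝ≥0∞) ^ (p / 2) ∂ν) ^ r ≤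
      ((∫⁻ x, (Γf x : ℝ≥0∞) ^ (p / 2) ∂ν + ∫⁻ x, (Γg x : ℝ≥0∞) ^ (p / 2) ∂ν) / 2) ^ r := by
  have hp : 0 ≤ p / 2 := by
    by_contra! h
    nlinarith
  have hr0 : 0 ≤ r := by linarith
  rw [← lintegral_add_left (by fun_prop), div_eq_mul_inv (lintegral _ _),
    ← lintegral_mul_const' _ _ (by simp)]
  refine lintegral_rpow_add_lintegral_rpow_le hr (by fun_prop) (by fun_prop) ?_
  filter_upwards [hpar, hCS] with x hx hx'
  have key := rpow_rpow_add_rpow_rpow_le_of_parallelogram hr hpr (Γf x).coe_nonneg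
    (Γg x).coe_nonneg (Γplus x).coe_nonneg (Γminus x).coe_nonneg (by exact_mod_cast hx) hx'.1 hx'.2
  have key' : (Γplus x ^ (p / 2)) ^ r + (Γminus x ^ (p / 2)) ^ r ≤
      ((Γf x ^ (p / 2) + Γg x ^ (p / 2)) / 2) ^ r := by exact_mod_cast key
  rw [← div_eq_mul_inv]
  simp only [← ENNReal.coe_rpow_of_nonneg _ hp, ← ENNReal.coe_rpow_of_nonneg _ hr0,
    ← ENNReal.coe_add]
  rw [show (2 : ℝ≥0∞) = ((2 : NNReal) : ℝ≥0∞) from rfl, ← ENNReal.coe_div two_ne_zero,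
    ← ENNReal.coe_rpow_of_nonneg _ hr0]
  exact_mod_cast key'

lemma lintegral_abs_rpow_rpow_add_le {X : Type*} [MeasurableSpace X]
    {ν : Measure X} {p r : ℝ} (hr : 1 ≤ r) (hpr : r * (p - 1) = 1) {f g : X → ℝ}
    (hf : Measurable f) (hg : Measurable g) :
    (∫⁻ x, ENNReal.ofReal (|(f x + g x) / 2| ^ p) ∂ν) ^ r +
        (∫⁻ x, ENNReal.ofReal (|(f x - g x) / 2| ^ p) ∂ν) ^ r ≤
      ((∫⁻ x, ENNReal.ofReal (|f x| ^ p) ∂ν + ∫⁻ x, ENNReal.ofReal (|g x| ^ p) ∂ν) / 2) ^ r := by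
  have hp : 0 ≤ p := by
    by_contra! h
    nlinarith
  have hofReal : ∀ t : ℝ, ENNReal.ofReal (|t| ^ p) =
      ((‖t‖₊ ^ 2 : NNReal) : ℝ≥0∞) ^ (p / 2) := fun t => by
    rw [← ENNReal.ofReal_rpow_of_nonneg (abs_nonneg t) hp, ENNReal.coe_pow, ← ENNReal.rpow_natCast,
      ← ENNReal.rpow_mul, ← ENNReal.ofReal_coe_nnreal, coe_nnnorm,
      Real.norm_eq_abs]
    congr 1
    push_cast
    ring
  simp only [hofReal]
  refine lintegral_rpow_half_rpow_add_le_of_parallelogram hr hpr (by fun_prop) (by fun_prop)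
    (by fun_prop) (.of_forall fun x => ?_) (.of_forall fun x => ?_)
  · apply NNReal.eq
    push_cast
    simp only [Real.norm_eq_abs, sq_abs]
    ring
  · push_cast
    simp only [Real.norm_eq_abs, sq_abs, Real.sqrt_sq_eq_abs]
    rw [sub_sq, add_sq, sq_abs, sq_abs]
    have h1 := abs_le.1 (abs_mul (f x) (g x)).le
    constructor <;> nlinarith

theorem clarkson_type_inequality_p_le_two {X : Type*} [MeasurableSpace X]
    (μ m : Measure X) (p α : ℝ) (hp1 : 1 < p) (hp2 : p ≤ 2) (hα : 0 ≤ α)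
    (f g : X → ℝ) (hf : Measurable f) (hg : Measurable g)
    (hfp : ∫⁻ x, ENNReal.ofReal (|f x| ^ p) ∂m < ∞)
    (hgp : ∫⁻ x, ENNReal.ofReal (|g x| ^ p) ∂m < ∞)
    (Γf Γg Γplus Γminus : X → NNReal)
    (hΓf : Measurable Γf) (hΓg : Measurable Γg)
    (hΓplus : Measurable Γplus) (hΓminus : Measurable Γminus)
    (hΓfp : ∫⁻ x, (Γf x : ℝ≥0∞) ^ (p / 2) ∂μ < ∞)
    (hΓgp : ∫⁻ x, (Γg x : ℝ≥0∞) ^ (p / 2) ∂μ < ∞)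
    (hpar : ∀ᵐ x ∂μ, Γplus x + Γminus x = (Γf x + Γg x) / 2)
    (hCS : ∀ᵐ x ∂μ,
      (Real.sqrt (Γf x) - Real.sqrt (Γg x)) ^ 2 ≤ 4 * (Γplus x : ℝ) ∧
        4 * (Γplus x : ℝ) ≤ (Real.sqrt (Γf x) + Real.sqrt (Γg x)) ^ 2) :
    (energyAlpha μ m p α (fun x => (f x + g x) / 2) Γplus) ^ (1 / (p - 1))
      + (energyAlpha μ m p α (fun x => (f x - g x) / 2) Γminus) ^ (1 / (p - 1))
      ≤ ((energyAlpha μ m p α f Γf + energyAlpha μ m p α g Γg) / 2) ^ (1 / (p - 1)) := by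
  have hr : 1 ≤ 1 / (p - 1) := (one_le_div (by linarith)).2 (by linarith)
  have hpr : 1 / (p - 1) * (p - 1) = 1 := one_div_mul_cancel (by linarith)
  have hr0 : 0 ≤ 1 / (p - 1) := by linarith
  have hμ := lintegral_rpow_half_rpow_add_le_of_parallelogram hr hpr hΓf hΓplus hΓminus hpar hCS
  have hm := mul_le_mul_right (lintegral_abs_rpow_rpow_add_le (ν := m) hr hpr hf hg)
    (ENNReal.ofReal α ^ (1 / (p - 1)))
  rw [mul_add, ← ENNReal.mul_rpow_of_nonneg _ _ hr0, ← ENNReal.mul_rpow_of_nonneg _ _ hr0,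
    ← ENNReal.mul_rpow_of_nonneg _ _ hr0] at hm
  refine (add_rpow_add_add_rpow_le hr hμ hm).trans_eq ?_
  congr 1
  simp only [energyAlpha, div_eq_mul_inv]
  ring
end

section
/- Let p ∈ (1, 2], set q := p/(p−1), and let a, b, c, d be nonnegative real numbers satisfying a + b = (c + d)/2 and (√c − √d)² ≤ 4a ≤ (√c + √d)². Then a^{q/2} + b^{q/2} ≤ ((c^{p/2} + d^{p/2})/2)^{q/p}. -/
/-- Riesz–Thorin interpolation, between the exponents `1` and `2`, for the bilinear form
`(u₁, u₂), (x₁, x₂) ↦ (u₁ + u₂) x₁ + (u₁ - u₂) x₂`. -/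
lemma rpow_add_mul_add_rpow_sub_mul_le {r s₁ s₂ t₁ t₂ : ℝ} (hr : 1 / 2 ≤ r) (hr1 : r ≤ 1)
    (hs₁ : 0 ≤ s₁) (hs₂ : 0 ≤ s₂) (ht₁ : 0 ≤ t₁) (ht₂ : 0 ≤ t₂) :
    (s₁ ^ r + s₂ ^ r) * t₁ ^ r + (s₁ ^ r - s₂ ^ r) * t₂ ^ r
      ≤ 2 ^ (1 - r) * ((s₁ + s₂) * (t₁ + t₂)) ^ r := by
  set F : ℂ → ℂ := fun w ↦ ((s₁ : ℂ) ^ w + (s₂ : ℂ) ^ w) * (t₁ : ℂ) ^ w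
    + ((s₁ : ℂ) ^ w - (s₂ : ℂ) ^ w) * (t₂ : ℂ) ^ w with hF
  have norm_cpow {t : ℝ} (ht : 0 ≤ t) {w : ℂ} (hw : 0 < w.re) : ‖(t : ℂ) ^ w‖ = t ^ w.re :=
    Complex.norm_cpow_eq_rpow_re_of_nonneg ht hw.ne'
  have hF_le (w : ℂ) (hw : 0 < w.re) : ‖F w‖
      ≤ (s₁ ^ w.re + s₂ ^ w.re) * (t₁ ^ w.re + t₂ ^ w.re) := by
    rw [← norm_cpow hs₁ hw, ← norm_cpow hs₂ hw, ← norm_cpow ht₁ hw, ← norm_cpow ht₂ hw, mul_add]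
    refine (norm_add_le _ _).trans ?_
    rw [norm_mul, norm_mul]
    gcongr
    · exact norm_add_le _ _
    · exact norm_sub_le _ _
  have hdiff : DiffContOnCl ℂ F (Complex.HadamardThreeLines.verticalStrip (1 / 2) 1) := by
    refine DifferentiableOn.diffContOnCl fun w hw ↦ DifferentiableAt.differentiableWithinAt ?_
    have hw' : w ≠ 0 := by
      have : w ∈ Complex.re ⁻¹' Set.Icc (1 / 2) 1 :=
        closure_minimal (Set.preimage_mono Set.Ioo_subset_Icc_self)
          (isClosed_Icc.preimage Complex.continuous_re) hw
      rintro rfl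
      norm_num at this
    have cpow_diff (t : ℝ) : DifferentiableAt ℂ (fun w : ℂ ↦ (t : ℂ) ^ w) w :=
      differentiableAt_id.const_cpow (Or.inr hw')
    exact (((cpow_diff _).add (cpow_diff _)).mul (cpow_diff _)).add
      (((cpow_diff _).sub (cpow_diff _)).mul (cpow_diff _))
  have hbdd : BddAbove
      ((norm ∘ F) '' Complex.HadamardThreeLines.verticalClosedStrip (1 / 2) 1) := by
    refine ⟨((s₁ + 1) + (s₂ + 1)) * ((t₁ + 1) + (t₂ + 1)), ?_⟩
    rintro _ ⟨w, ⟨hw, hw1⟩, rfl⟩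
    have hw0 : 0 < w.re := by linarith
    have rpow_le {t : ℝ} (ht : 0 ≤ t) : t ^ w.re ≤ t + 1 := by
      have := Real.geom_mean_le_arith_mean2_weighted hw0.le (sub_nonneg.2 hw1) ht zero_le_one
        (by ring)
      rw [Real.one_rpow] at this
      nlinarith
    refine (hF_le w hw0).trans ?_
    gcongr <;> exact rpow_le ‹_›
  have hone (w : ℂ) (hw : w ∈ Complex.re ⁻¹' {1}) : ‖F w‖ ≤ (s₁ + s₂) * (t₁ + t₂) := by
    have hw : w.re = 1 := hw
    simpa [hw] using hF_le w (by simp [hw])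
  have hhalf (w : ℂ) (hw : w ∈ Complex.re ⁻¹' {1 / 2}) :
      ‖F w‖ ≤ (2 * ((s₁ + s₂) * (t₁ + t₂))) ^ (1 / 2 : ℝ) := by
    have hw : w.re = 1 / 2 := hw
    have sq_norm {t : ℝ} (ht : 0 ≤ t) : ‖(t : ℂ) ^ w‖ ^ 2 = t := by
      rw [norm_cpow ht (by rw [hw]; norm_num), hw, ← Real.sqrt_eq_rpow, Real.sq_sqrt ht]
    rw [← Real.sqrt_eq_rpow]
    apply Real.le_sqrt_of_sq_le
    have hpar := parallelogram_law_with_norm ℝ ((s₁ : ℂ) ^ w) ((s₂ : ℂ) ^ w)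
    have htri : ‖F w‖ ≤ ‖(s₁ : ℂ) ^ w + (s₂ : ℂ) ^ w‖ * ‖(t₁ : ℂ) ^ w‖
        + ‖(s₁ : ℂ) ^ w - (s₂ : ℂ) ^ w‖ * ‖(t₂ : ℂ) ^ w‖ := by
      simpa only [norm_mul] using norm_add_le
        (((s₁ : ℂ) ^ w + (s₂ : ℂ) ^ w) * (t₁ : ℂ) ^ w) (((s₁ : ℂ) ^ w - (s₂ : ℂ) ^ w) * (t₂ : ℂ) ^ w)
    calc ‖F w‖ ^ 2 ≤ _ := pow_le_pow_left₀ (norm_nonneg _) htri 2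
      _ ≤ (‖(s₁ : ℂ) ^ w + (s₂ : ℂ) ^ w‖ ^ 2 + ‖(s₁ : ℂ) ^ w - (s₂ : ℂ) ^ w‖ ^ 2)
          * (‖(t₁ : ℂ) ^ w‖ ^ 2 + ‖(t₂ : ℂ) ^ w‖ ^ 2) := by
        nlinarith [sq_nonneg (‖(s₁ : ℂ) ^ w + (s₂ : ℂ) ^ w‖ * ‖(t₂ : ℂ) ^ w‖
          - ‖(s₁ : ℂ) ^ w - (s₂ : ℂ) ^ w‖ * ‖(t₁ : ℂ) ^ w‖)]
      _ = 2 * (‖(s₁ : ℂ) ^ w‖ ^ 2 + ‖(s₂ : ℂ) ^ w‖ ^ 2)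
          * (‖(t₁ : ℂ) ^ w‖ ^ 2 + ‖(t₂ : ℂ) ^ w‖ ^ 2) := by
        rw [show ‖(s₁ : ℂ) ^ w + (s₂ : ℂ) ^ w‖ ^ 2 + ‖(s₁ : ℂ) ^ w - (s₂ : ℂ) ^ w‖ ^ 2
          = 2 * (‖(s₁ : ℂ) ^ w‖ ^ 2 + ‖(s₂ : ℂ) ^ w‖ ^ 2) by linarith]
      _ = 2 * ((s₁ + s₂) * (t₁ + t₂)) := by
        rw [sq_norm hs₁, sq_norm hs₂, sq_norm ht₁, sq_norm ht₂, mul_assoc]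
  have hST : 0 ≤ (s₁ + s₂) * (t₁ + t₂) := by positivity
  have key := Complex.HadamardThreeLines.norm_le_interp_of_mem_verticalClosedStrip'
    (z := (r : ℂ)) (by norm_num) ⟨hr, hr1⟩ hdiff hbdd hhalf hone
  have hFr : F r = (((s₁ ^ r + s₂ ^ r) * t₁ ^ r + (s₁ ^ r - s₂ ^ r) * t₂ ^ r : ℝ) : ℂ) := by
    simp [hF, Complex.ofReal_cpow, hs₁, hs₂, ht₁, ht₂]
  rw [hFr, Complex.norm_real, Complex.ofReal_re] at key
  refine (Real.le_norm_self _).trans (key.trans_eq ?_)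
  rw [← Real.rpow_mul (by positivity), Real.mul_rpow zero_le_two hST, mul_assoc,
    show 1 / 2 * (1 - (r - 1 / 2) / (1 - 1 / 2)) = 1 - r by ring,
    show (r - 1 / 2) / (1 - 1 / 2) = 2 * r - 1 by ring,
    ← Real.rpow_add_of_nonneg hST (by linarith) (by linarith)]
  congr 2
  ring

/-- The second Clarkson inequality for two real numbers. -/
lemma rpow_half_add_add_rpow_half_sub_le {p q x y : ℝ} (hpq : p.HolderConjugate q) (hp2 : p ≤ 2)
    (hy : 0 ≤ y) (hxy : y ≤ x) :
    ((x + y) / 2) ^ q + ((x - y) / 2) ^ q ≤ ((x ^ p + y ^ p) / 2) ^ (q / p) := by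
  have hp := hpq.pos
  have hq := hpq.symm.pos
  have hx : 0 ≤ x := hy.trans hxy
  have hX : 0 ≤ (x + y) / 2 := by linarith
  have hY : 0 ≤ (x - y) / 2 := by linarith
  set X := (x + y) / 2 with hXdef
  set Y := (x - y) / 2 with hYdef
  have hS : 0 ≤ x ^ p + y ^ p := by positivity
  obtain hT | hT := (show 0 ≤ X ^ q + Y ^ q by positivity).eq_or_lt
  · rw [← hT]
    positivity
  have key := rpow_add_mul_add_rpow_sub_mul_le (r := 1 / p) (one_div_le_one_div_of_le hp hp2)
    ((div_le_one hp).2 hpq.lt.le) (Real.rpow_nonneg hx p) (Real.rpow_nonneg hy p)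
    (Real.rpow_nonneg hX q) (Real.rpow_nonneg hY q)
  have root {t : ℝ} (ht : 0 ≤ t) : (t ^ p) ^ (1 / p) = t := by
    rw [← Real.rpow_mul ht, mul_one_div_cancel hp.ne', Real.rpow_one]
  have hqp : 1 + q * (1 / p) = q := by
    have := hpq.mul_eq_add
    field_simp
    linarith
  have mul_pow {t : ℝ} (ht : 0 ≤ t) : t * (t ^ q) ^ (1 / p) = t ^ q := by
    rw [← Real.rpow_mul ht]
    nth_rewrite 1 [← Real.rpow_one t]
    rw [← Real.rpow_add_of_nonneg ht zero_le_one (by positivity), hqp]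
  have hconj : 1 - 1 / p = 1 / q := by
    have := hpq.mul_eq_add
    field_simp
    linarith
  rw [root hx, root hy, show x + y = 2 * X by ring, show x - y = 2 * Y by ring, mul_assoc,
    mul_assoc, mul_pow hX, mul_pow hY, ← mul_add, Real.mul_rpow hS hT.le,
    Real.rpow_sub two_pos, Real.rpow_one] at key
  set T := X ^ q + Y ^ q
  have hsplit : T = T ^ (1 / q) * T ^ (1 / p) := by
    rw [← Real.rpow_add hT, ← hconj, sub_add_cancel, Real.rpow_one]
  have hroot : T ^ (1 / q) ≤ ((x ^ p + y ^ p) / 2) ^ (1 / p) := by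
    rw [Real.div_rpow hS zero_le_two]
    refine le_of_mul_le_mul_right ?_ (mul_pos two_pos (Real.rpow_pos_of_pos hT (1 / p)))
    calc T ^ (1 / q) * (2 * T ^ (1 / p)) = 2 * T := by
          nth_rewrite 3 [hsplit]
          ring
      _ ≤ _ := key
      _ = _ := by ring
  calc T = (T ^ (1 / q)) ^ q := by
        rw [← Real.rpow_mul hT.le, one_div_mul_cancel hq.ne', Real.rpow_one]
    _ ≤ (((x ^ p + y ^ p) / 2) ^ (1 / p)) ^ q := by gcongr
    _ = _ := by
        rw [← Real.rpow_mul (by positivity)]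
        congr 1
        ring

lemma ConvexOn.add_le_add_of_mem_Icc_s3 {s : Set ℝ} {f : ℝ → ℝ} (hf : ConvexOn ℝ s f)
    {x y a b : ℝ} (hx : x ∈ s) (hy : y ∈ s) (ha : a ∈ Set.Icc x y) (hab : a + b = x + y) :
    f a + f b ≤ f x + f y := by
  rw [← segment_eq_Icc (ha.1.trans ha.2)] at ha
  obtain ⟨l, m, hl, hm, hlm, rfl⟩ := ha
  have hb : b = m • x + l • y := by
    simp only [smul_eq_mul] at hab ⊢
    linear_combination hab - (x + y) * hlm
  have h₁ := hf.2 hx hy hl hm hlm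
  have h₂ := hf.2 hx hy hm hl (by linarith)
  rw [hb]
  simp only [smul_eq_mul] at h₁ h₂ ⊢
  linear_combination h₁ + h₂ + (f x + f y) * hlm

theorem pointwise_reverse_clarkson (p a b c d : ℝ) (hp1 : 1 < p) (hp2 : p ≤ 2)
    (ha : 0 ≤ a) (hb : 0 ≤ b) (hc : 0 ≤ c) (hd : 0 ≤ d)
    (hpar : a + b = (c + d) / 2)
    (hlow : (Real.sqrt c - Real.sqrt d) ^ 2 ≤ 4 * a)
    (hup : 4 * a ≤ (Real.sqrt c + Real.sqrt d) ^ 2) :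
    a ^ ((p / (p - 1)) / 2) + b ^ ((p / (p - 1)) / 2)
      ≤ ((c ^ (p / 2) + d ^ (p / 2)) / 2) ^ ((p / (p - 1)) / p) := by
  wlog h : d ≤ c generalizing c d
  · rw [add_comm (c ^ _)]
    exact this d c hd hc (by linarith) (by linarith) (by linarith) (le_of_not_ge h)
  have hpq : p.HolderConjugate (p / (p - 1)) := Real.HolderConjugate.conjExponent hp1
  have hq2 : 1 ≤ p / (p - 1) / 2 := by
    rw [div_div, one_le_div (by linarith)]
    linarith
  have hsqrt := Real.sqrt_le_sqrt h
  have hd' := Real.sqrt_nonneg d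
  have sqrt_rpow {t : ℝ} (ht : 0 ≤ t) : t ^ (p / 2) = √t ^ p := by
    rw [Real.sqrt_eq_rpow, ← Real.rpow_mul ht]
    congr 1
    ring
  have sq_rpow {t : ℝ} (ht : 0 ≤ t) : (t ^ 2) ^ (p / (p - 1) / 2) = t ^ (p / (p - 1)) := by
    rw [← Real.rpow_natCast, ← Real.rpow_mul ht]
    congr 1
    push_cast
    ring
  have hconv := (convexOn_rpow hq2).add_le_add_of_mem_Icc_s3 (x := ((√c - √d) / 2) ^ 2)
    (y := ((√c + √d) / 2) ^ 2) (a := a) (b := b)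
    (Set.mem_Ici.2 (sq_nonneg _)) (Set.mem_Ici.2 (sq_nonneg _))
    ⟨by linarith, by linarith⟩ (by nlinarith [Real.sq_sqrt hc, Real.sq_sqrt hd])
  rw [sq_rpow (by linarith), sq_rpow (by linarith), add_comm (((√c - √d) / 2) ^ _)] at hconv
  rw [sqrt_rpow hc, sqrt_rpow hd]
  exact hconv.trans (rpow_half_add_add_rpow_half_sub_le hpq hp2 hd' hsqrt)
end

section
/- Let N ≥ 1 and let T : ℝ^N → ℝ be a generalized normal contraction. Then for every ε > 0 there exists a C^∞ generalized normal contraction S : ℝ^N → ℝ such that |S(x) − T(x)| ≤ ε for all x ∈ ℝ^N. In particular, there is a sequence (T_n) of C^∞ generalized normal contractions converging to T uniformly on ℝ^N. -/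
/-- A generalized normal contraction `T : ℝ^N → ℝ`: `T(0) = 0` and
`|T(x) - T(y)| ≤ ∑ₖ |xₖ - yₖ|`. -/
def IsNormalContraction (N : ℕ) (T : (Fin N → ℝ) → ℝ) : Prop :=
  T 0 = 0 ∧ ∀ x y : Fin N → ℝ, |T x - T y| ≤ ∑ k, |x k - y k|

open MeasureTheory ContinuousLinearMap
open scoped Convolution

namespace ContDiffBump

variable {G : Type*} [NormedAddCommGroup G] [NormedSpace ℝ G] [FiniteDimensional ℝ G]
  [MeasurableSpace G] [BorelSpace G] {μ : Measure G} [μ.IsAddHaarMeasure]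

/-- Convolving a continuous function with a normed bump function preserves every
translation-invariant bound on its increments. -/
theorem abs_normed_convolution_sub_le (φ : ContDiffBump (0 : G)) {f : G → ℝ} (hf : Continuous f)
    {x y : G} {C : ℝ} (h : ∀ t, |f (x - t) - f (y - t)| ≤ C) :
    |(φ.normed μ ⋆[lsmul ℝ ℝ, μ] f) x - (φ.normed μ ⋆[lsmul ℝ ℝ, μ] f) y| ≤ C := by
  have hex : ConvolutionExists (φ.normed μ) f (lsmul ℝ ℝ) μ :=
    φ.hasCompactSupport_normed.convolutionExists_left _ φ.continuous_normed hf.locallyIntegrable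
  rw [convolution_def, convolution_def, ← integral_sub (hex x) (hex y)]
  have hbound : ∀ t, ‖lsmul ℝ ℝ (φ.normed μ t) (f (x - t)) -
      lsmul ℝ ℝ (φ.normed μ t) (f (y - t))‖ ≤ φ.normed μ t * C := by
    intro t
    rw [← map_sub, lsmul_apply, norm_smul, Real.norm_of_nonneg (φ.nonneg_normed t)]
    exact mul_le_mul_of_nonneg_left (h t) (φ.nonneg_normed t)
  have := norm_integral_le_of_norm_le (φ.integrable_normed.mul_const C)
    (Filter.Eventually.of_forall hbound)
  rwa [integral_mul_const, φ.integral_normed, one_mul] at this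

end ContDiffBump

namespace IsNormalContraction

variable {N : ℕ} {T : (Fin N → ℝ) → ℝ}

theorem lipschitzWith (hT : IsNormalContraction N T) : LipschitzWith N T := by
  refine LipschitzWith.of_dist_le_mul fun x y => (hT.2 x y).trans ?_
  calc ∑ k, |x k - y k| ≤ ∑ _k : Fin N, dist x y :=
        Finset.sum_le_sum fun k _ => dist_le_pi_dist x y k
    _ = ((N : NNReal) : ℝ) * dist x y := by simp

theorem exists_contDiff_approx (hT : IsNormalContraction N T) {ε : ℝ} (hε : 0 < ε) :
    ∃ S : (Fin N → ℝ) → ℝ,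
      ContDiff ℝ (⊤ : ℕ∞) S ∧ IsNormalContraction N S ∧ ∀ x, |S x - T x| ≤ ε := by
  have hr : 0 < ε / (2 * (N + 1)) := by positivity
  let φ : ContDiffBump (0 : Fin N → ℝ) := ⟨_, _, half_pos hr, half_lt_self hr⟩
  have hcont := hT.lipschitzWith.continuous
  set F : (Fin N → ℝ) → ℝ := φ.normed volume ⋆[lsmul ℝ ℝ, volume] T
  have hF : ∀ x, |F x - T x| ≤ ε / 2 := by
    intro x
    refine φ.dist_normed_convolution_le hcont.aestronglyMeasurable fun y hy => ?_
    calc dist (T y) (T x) ≤ N * dist y x := by simpa using hT.lipschitzWith.dist_le_mul y x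
      _ ≤ (N + 1) * (ε / (2 * (N + 1))) := by
        gcongr
        · linarith
        · exact (Metric.mem_ball.mp hy).le
      _ = ε / 2 := by field_simp
  refine ⟨fun x => F x - F 0, ?_, ⟨sub_self _, fun x y => ?_⟩, fun x => ?_⟩
  · exact (φ.hasCompactSupport_normed.contDiff_convolution_left _ φ.contDiff_normed
      hcont.locallyIntegrable).sub contDiff_const
  · rw [sub_sub_sub_cancel_right]
    exact φ.abs_normed_convolution_sub_le hcont fun t => by simpa using hT.2 (x - t) (y - t)
  · have hx := abs_le.mp (hF x)
    have h0 := abs_le.mp (hF 0)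
    rw [hT.1] at h0
    exact abs_le.mpr ⟨by linarith, by linarith⟩

end IsNormalContraction

theorem smooth_approximation_of_normal_contraction (N : ℕ) (hN : 1 ≤ N)
    (T : (Fin N → ℝ) → ℝ) (hT : IsNormalContraction N T) :
    (∀ ε : ℝ, 0 < ε → ∃ S : (Fin N → ℝ) → ℝ,
      ContDiff ℝ (⊤ : ℕ∞) S ∧ IsNormalContraction N S ∧ ∀ x, |S x - T x| ≤ ε) ∧
    ∃ Tn : ℕ → (Fin N → ℝ) → ℝ,
      (∀ n, ContDiff ℝ (⊤ : ℕ∞) (Tn n) ∧ IsNormalContraction N (Tn n)) ∧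
      TendstoUniformly Tn T Filter.atTop := by
  refine ⟨fun ε hε => hT.exists_contDiff_approx hε, ?_⟩
  choose Tn hsmooth hcontr happrox using fun n : ℕ =>
    hT.exists_contDiff_approx (Nat.one_div_pos_of_nat (α := ℝ) (n := n))
  refine ⟨Tn, fun n => ⟨hsmooth n, hcontr n⟩, Metric.tendstoUniformly_iff.mpr fun ε hε => ?_⟩
  filter_upwards [tendsto_one_div_add_atTop_nhds_zero_nat.eventually_lt_const hε] with n hn x
  rw [dist_comm]
  exact (happrox n x).trans_lt hn
end
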